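/- Let X be a finite set with |X| = n, and let P ⊆ 2^X be a δ-separated family (1 ≤ δ ≤ n) in which every set has size exactly l (with δ ≤ l ≤ n), and suppose that for every Y ⊆ X with |Y| = m and every 1 ≤ k ≤ m, the number of sets of size at most k in the projection {P ∩ Y : P ∈ P} is at most C·m^{d₁}·k^{d₂}, where C > 0, d₁ ≥ 1, d₂ ≥ 0 are constants with d = d₁ + d₂ > 1. Then there exists a constant c* depending only on C, d₁, d₂ (independent of n, l, δ) such that |P| ≤ c*·(n/δ)^{d₁}·(l/δ)^{d₂}. -/

import Mathlib

open scoped symmDiff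

namespace SSP
open Finset

variable {ι : Type} [DecidableEq ι]

/-- edges in direction `i` -/
def edg (𝒜 : Finset (Finset ι)) (i : ι) : Finset (Finset ι) :=
  𝒜.filter fun S => i ∉ S ∧ insert i S ∈ 𝒜

lemma edge_dir (𝒜 : Finset (Finset ι)) (a : ι) :
    (edg 𝒜 a) = 𝒜.nonMemberSubfamily a ∩ 𝒜.memberSubfamily a := by
  ext S
  simp only [edg, mem_filter, mem_inter, mem_nonMemberSubfamily, mem_memberSubfamily]
  tauto

lemma edge_split (𝒜 : Finset (Finset ι)) (a i : ι) (h : i ≠ a) :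
    #(edg 𝒜 i) = #(edg (𝒜.nonMemberSubfamily a) i) + #(edg (𝒜.memberSubfamily a) i) := by
  rw [← card_memberSubfamily_add_card_nonMemberSubfamily a (edg 𝒜 i), add_comm]
  congr 2
  · ext S
    simp only [edg, mem_filter, mem_nonMemberSubfamily, mem_insert]
    have : a ≠ i := h.symm
    tauto
  · ext S
    simp only [edg, mem_filter, mem_memberSubfamily, mem_insert, Finset.insert_comm a i]
    have : a ≠ i := h.symm
    tauto

lemma edge_super (N M : Finset (Finset ι)) (i : ι) :
    #(edg N i) + #(edg M i) ≤ #(edg (N ∪ M) i) + #(edg (N ∩ M) i) := by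
  rw [← card_union_add_card_inter]
  apply add_le_add <;> apply card_le_card
  · intro S
    simp only [edg, mem_filter, mem_union]; tauto
  · intro S
    simp only [edg, mem_filter, mem_inter]; tauto

lemma shat_union (𝒜 : Finset (Finset ι)) (a : ι) (S : Finset ι)
    (h : (𝒜.nonMemberSubfamily a ∪ 𝒜.memberSubfamily a).Shatters S) : 𝒜.Shatters S := by
  have haS : a ∉ S := by
    intro ha
    obtain ⟨u, hu, hSu⟩ := h (Subset.refl S)
    have : a ∈ u := by rw [← hSu] at ha; exact (mem_inter.1 ha).2
    simp only [mem_union, mem_nonMemberSubfamily, mem_memberSubfamily] at hu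
    tauto
  intro t ht
  obtain ⟨u, hu, hSu⟩ := h ht
  simp only [mem_union, mem_nonMemberSubfamily, mem_memberSubfamily] at hu
  rcases hu with hu | hu
  · exact ⟨u, hu.1, hSu⟩
  · exact ⟨insert a u, hu.1, by rw [inter_insert_of_notMem haS, hSu]⟩

lemma shat_inter (𝒜 : Finset (Finset ι)) (a : ι) (S : Finset ι)
    (h : (𝒜.nonMemberSubfamily a ∩ 𝒜.memberSubfamily a).Shatters S) :
    a ∉ S ∧ 𝒜.Shatters (insert a S) := by
  have haS : a ∉ S := by
    intro ha
    obtain ⟨u, hu, hSu⟩ := h (Subset.refl S)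
    have : a ∈ u := by rw [← hSu] at ha; exact (mem_inter.1 ha).2
    simp only [mem_inter, mem_nonMemberSubfamily, mem_memberSubfamily] at hu
    tauto
  refine ⟨haS, ?_⟩
  intro t ht
  have ht' : t.erase a ⊆ S := by
    intro x hx
    have := ht (mem_of_mem_erase hx)
    exact (mem_insert.1 this).resolve_left (ne_of_mem_erase hx)
  obtain ⟨u, hu, hSu⟩ := h ht'
  simp only [mem_inter, mem_nonMemberSubfamily, mem_memberSubfamily] at hu
  obtain ⟨⟨hu1, hau⟩, hu2, -⟩ := hu
  by_cases hat : a ∈ t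
  · refine ⟨insert a u, hu2, ?_⟩
    rw [← Finset.insert_inter_distrib, hSu, insert_erase hat]
  · refine ⟨u, hu1, ?_⟩
    rw [insert_inter_of_notMem hau, hSu, erase_eq_of_notMem hat]

lemma edge_bound [Fintype ι] (U : Finset ι) : ∀ (𝒜 : Finset (Finset ι)) (d : ℕ),
    (∀ S ∈ 𝒜, S ⊆ U) → (∀ S, 𝒜.Shatters S → #S ≤ d) → ∑ i, #(edg 𝒜 i) ≤ d * #𝒜 := by
  induction U using Finset.induction_on with
  | empty =>
    intro 𝒜 d hU _
    rw [Finset.sum_eq_zero]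
    · exact Nat.zero_le _
    intro i _
    rw [card_eq_zero, edg, filter_eq_empty_iff]
    rintro S hS ⟨_, h2⟩
    have := hU _ h2 (mem_insert_self i S)
    simp at this
  | insert a U ha ih =>
    intro 𝒜 d hU hd
    set N := 𝒜.nonMemberSubfamily a with hN
    set M := 𝒜.memberSubfamily a with hM
    have hNU : ∀ S ∈ N, S ⊆ U := by
      intro S hS x hx
      rw [hN, mem_nonMemberSubfamily] at hS
      rcases mem_insert.1 (hU _ hS.1 hx) with rfl | h
      · exact absurd hx hS.2
      · exact h
    have hMU : ∀ S ∈ M, S ⊆ U := by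
      intro S hS x hx
      rw [hM, mem_memberSubfamily] at hS
      rcases mem_insert.1 (hU _ hS.1 (mem_insert_of_mem hx)) with rfl | h
      · exact absurd hx hS.2
      · exact h
    have h1 : ∑ i, #(edg (N ∪ M) i) ≤ d * #(N ∪ M) := by
      apply ih
      · intro S hS; rcases mem_union.1 hS with h | h
        exacts [hNU S h, hMU S h]
      · intro S hS; exact hd S (shat_union 𝒜 a S hS)
    have h2 : ∑ i, #(edg (N ∩ M) i) + #(N ∩ M) ≤ d * #(N ∩ M) := by
      rcases (N ∩ M).eq_empty_or_nonempty with h | h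
      · rw [h]; simp [edg]
      · have hd1 : 1 ≤ d := by
          have hsh : (N ∩ M).Shatters ∅ := by
            rw [Finset.shatters_empty]; exact h
          have := hd _ (shat_inter 𝒜 a ∅ hsh).2
          simpa using this
        obtain ⟨e, rfl⟩ := Nat.exists_eq_add_of_le' hd1
        have := ih (N ∩ M) e (fun S hS => hNU S (mem_inter.1 hS).1) (by
          intro S hS
          obtain ⟨x, y⟩ := shat_inter 𝒜 a S hS
          have := hd _ y
          rw [card_insert_of_notMem x] at this
          omega)
        rw [add_mul, one_mul]
        omega
    have hc : #𝒜 = #(N ∪ M) + #(N ∩ M) := by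
      rw [card_union_add_card_inter, add_comm]
      exact (card_memberSubfamily_add_card_nonMemberSubfamily a 𝒜).symm
    have h3 : ∑ i, #(edg 𝒜 i) ≤ ∑ i, (#(edg (N ∪ M) i) + #(edg (N ∩ M) i)
        + if i = a then #(N ∩ M) else 0) := by
      apply sum_le_sum
      intro i _
      by_cases hi : i = a
      · subst hi
        rw [if_pos rfl, edge_dir]
        exact Nat.le_add_left _ _
      · rw [if_neg hi, edge_split 𝒜 a i hi]
        exact edge_super N M i
    rw [sum_add_distrib, sum_add_distrib, Finset.sum_ite_eq' univ a] at h3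
    simp only [mem_univ, if_true] at h3
    rw [hc, mul_add]
    omega

/-- weighted version -/
lemma weighted [Fintype ι] (w : Finset ι → ℕ) (d : ℕ)
    (hd : ∀ S, (univ.filter fun T => 0 < w T).Shatters S → #S ≤ d) :
    ∑ i, ∑ S with i ∉ S, min (w S) (w (insert i S)) ≤ d * ∑ S, w S := by
  set B := ∑ S, w S with hB
  have hwB : ∀ S, w S ≤ B := fun S => single_le_sum (f := w) (fun _ _ => Nat.zero_le _) (mem_univ S)
  have key : ∀ x ≤ B, x = ∑ t ∈ range B, if t < x then 1 else 0 := by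
    intro x hx
    rw [← card_filter]
    have : (range B).filter (fun t => t < x) = range x := by
      ext t; simp only [mem_filter, mem_range]; omega
    rw [this, card_range]
  have e1 : ∑ i, ∑ S with i ∉ S, min (w S) (w (insert i S))
      = ∑ t ∈ range B, ∑ i, #(edg (univ.filter fun T => t < w T) i) := by
    rw [sum_comm]
    apply sum_congr rfl
    intro i _
    have : ∀ S, min (w S) (w (insert i S)) = ∑ t ∈ range B,
        if t < min (w S) (w (insert i S)) then 1 else 0 :=
      fun S => key _ ((min_le_left _ _).trans (hwB S))
    rw [sum_congr rfl (fun S _ => this S), sum_comm]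
    apply sum_congr rfl
    intro t _
    rw [← card_filter]
    congr 1
    ext S
    simp only [edg, mem_filter, mem_univ, true_and, lt_min_iff]
    tauto
  have e2 : B = ∑ t ∈ range B, #(univ.filter fun T => t < w T) := by
    conv_lhs => rw [hB, sum_congr rfl (fun S _ => key (w S) (hwB S)), sum_comm]
    apply sum_congr rfl
    intro t _
    rw [← card_filter]
  rw [e1]
  conv_rhs => rw [e2]
  rw [mul_sum]
  apply sum_le_sum
  intro t _
  apply edge_bound univ _ d (fun S _ => subset_univ S)
  intro S hS
  apply hd
  apply hS.mono_left
  intro T hT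
  simp only [mem_filter, mem_univ, true_and] at hT ⊢
  omega

variable {α : Type} [DecidableEq α]

lemma class_bound [Fintype α] (Q : Finset (Finset α)) (δ : ℕ)
    (hs : ∀ p ∈ Q, ∀ q ∈ Q, p ≠ q → δ < #(p ∆ q)) :
    δ * #Q ≤ 2 * ∑ a, min #(Q.filter fun p => a ∉ p) #(Q.filter fun p => a ∈ p) + δ := by
  rcases Q.eq_empty_or_nonempty with rfl | hne
  · simp
  have hb : 0 < #Q := card_pos.2 hne
  have s1 : ∀ a, #(Q.filter fun p => a ∉ p) * #(Q.filter fun p => a ∈ p) ≤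
      #Q * min #(Q.filter fun p => a ∉ p) #(Q.filter fun p => a ∈ p) := by
    intro a
    rcases min_choice #(Q.filter fun p => a ∉ p) #(Q.filter fun p => a ∈ p) with h | h <;> rw [h]
    · rw [mul_comm]; exact Nat.mul_le_mul_right _ (card_filter_le _ _)
    · exact Nat.mul_le_mul_right _ (card_filter_le _ _)
  have s2 : ∑ a, #(Q.filter fun p => a ∉ p) * #(Q.filter fun p => a ∈ p)
      = ∑ p ∈ Q, ∑ q ∈ Q, #(q \ p) := by
    have : ∀ p q : Finset α, #(q \ p) = ∑ a, if a ∉ p then (if a ∈ q then 1 else 0) else 0 := by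
      intro p q
      rw [← sum_filter, ← card_filter]
      congr 1
      ext a; simp [and_comm]
    simp_rw [this]
    rw [sum_congr rfl (fun p _ => sum_comm), sum_comm]
    apply sum_congr rfl
    intro a _
    rw [card_filter, card_filter, sum_mul_sum]
    apply sum_congr rfl
    intro p _
    apply sum_congr rfl
    intro q _
    by_cases h : a ∈ p <;> simp [h]
  have s3 : 2 * ∑ p ∈ Q, ∑ q ∈ Q, #(q \ p) = ∑ p ∈ Q, ∑ q ∈ Q, #(p ∆ q) := by
    rw [two_mul]
    conv_lhs => 
      arg 1
      rw [sum_comm]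
    rw [← sum_add_distrib]
    apply sum_congr rfl; intro p _
    rw [← sum_add_distrib]
    apply sum_congr rfl; intro q _
    rw [Finset.symmDiff_def, card_union_of_disjoint]
    exact disjoint_sdiff_sdiff
  have s4 : #Q * (#Q - 1) * δ ≤ ∑ p ∈ Q, ∑ q ∈ Q, #(p ∆ q) := by
    have : ∀ p ∈ Q, (#Q - 1) * δ ≤ ∑ q ∈ Q, #(p ∆ q) := by
      intro p hp
      rw [← card_erase_of_mem hp, ← smul_eq_mul]
      refine (card_nsmul_le_sum _ (fun q => #(p ∆ q)) δ ?_).trans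
        (sum_le_sum_of_subset (erase_subset p Q))
      intro q hq
      exact (hs p hp q (mem_of_mem_erase hq) (ne_of_mem_erase hq).symm).le
    rw [mul_assoc, ← smul_eq_mul]
    exact card_nsmul_le_sum _ _ _ this
  have s5 : #Q * ((#Q - 1) * δ) ≤ #Q * (2 * ∑ a, min #(Q.filter fun p => a ∉ p) #(Q.filter fun p => a ∈ p)) := by
    calc _ = #Q * (#Q - 1) * δ := by ring
      _ ≤ _ := s4
      _ = 2 * ∑ a, #(Q.filter fun p => a ∉ p) * #(Q.filter fun p => a ∈ p) := by rw [← s3, s2]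
      _ ≤ 2 * ∑ a, #Q * min #(Q.filter fun p => a ∉ p) #(Q.filter fun p => a ∈ p) :=
          Nat.mul_le_mul_left _ (sum_le_sum fun a _ => s1 a)
      _ = _ := by rw [← mul_sum]; ring
  have s6 := Nat.le_of_mul_le_mul_left s5 hb
  obtain ⟨e, he⟩ := Nat.exists_eq_add_of_le' hb
  rw [he] at s6 ⊢
  simp only [Nat.add_sub_cancel] at s6
  rw [Nat.succ_eq_add_one, zero_add, mul_add, mul_comm δ e, mul_one]
  omega

/-- trace of `p` along the sample `f` -/
def tr [Fintype ι] (f : ι → α) (p : Finset α) : Finset ι := univ.filter fun j => f j ∈ p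

/-- weight -/
def wt [Fintype ι] (P : Finset (Finset α)) (f : ι → α) (S : Finset ι) : ℕ :=
  #(P.filter fun p => tr f p = S)

/-- weight of edges in direction `i` -/
def W [Fintype ι] (P : Finset (Finset α)) (f : ι → α) (i : ι) : ℕ :=
  ∑ S with i ∉ S, min (wt P f S) (wt P f (insert i S))

lemma W_lower [Fintype ι] [Fintype α] (P : Finset (Finset α)) (δ : ℕ)
    (hs : ∀ p ∈ P, ∀ q ∈ P, p ≠ q → δ < #(p ∆ q)) (f : ι → α) (i : ι) :
    δ * #P ≤ 2 * ∑ a, W P (Function.update f i a) i + δ * #(P.image (tr f)) := by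
  set e : Finset α → Finset ι := fun p => (tr f p).erase i with he
  set T := P.image e with hT
  have hTle : #T ≤ #(P.image (tr f)) := by
    have : T = (P.image (tr f)).image (fun S => S.erase i) := by
      rw [image_image]; rfl
    rw [this]; exact card_image_le
  have hiT : ∀ S ∈ T, i ∉ S := by
    intro S hS
    obtain ⟨p, _, rfl⟩ := mem_image.1 hS
    simp [he]
  have hu : ∀ a p, tr (Function.update f i a) p = if a ∈ p then insert i (e p) else e p := by
    intro a p
    ext j
    by_cases hj : j = i
    · subst hj
      by_cases h : a ∈ p <;> simp [tr, he, h]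
    · by_cases h : a ∈ p <;> simp [tr, he, h, hj]
  have hie : ∀ p, i ∉ e p := fun p => by simp [he]
  have w1 : ∀ a S, i ∉ S → wt P (Function.update f i a) S
      = #((P.filter fun p => e p = S).filter fun p => a ∉ p) := by
    intro a S hS
    rw [wt, filter_filter]
    congr 1
    apply filter_congr
    intro p _
    rw [hu]
    by_cases h : a ∈ p
    · simp only [h, if_true, not_true, and_false, iff_false]
      rintro rfl; exact hS (mem_insert_self _ _)
    · simp [h]
  have w2 : ∀ a S, i ∉ S → wt P (Function.update f i a) (insert i S)
      = #((P.filter fun p => e p = S).filter fun p => a ∈ p) := by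
    intro a S hS
    rw [wt, filter_filter]
    congr 1
    apply filter_congr
    intro p _
    rw [hu]
    by_cases h : a ∈ p
    · simp only [h, if_true, and_true]
      constructor
      · intro h'
        have := congrArg (fun s => s.erase i) h'
        simpa [erase_insert, hS, hie p] using this
      · rintro rfl; rfl
    · simp only [h, if_false, and_false, iff_false]
      intro h'; exact hie p (h' ▸ mem_insert_self _ _)
  have hP : #P = ∑ S ∈ T, #(P.filter fun p => e p = S) :=
    card_eq_sum_card_fiberwise (fun p hp => mem_image_of_mem e hp)
  have step : ∑ S ∈ T, (δ * #(P.filter fun p => e p = S)) ≤ ∑ S ∈ T,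
      (2 * ∑ a, min (wt P (Function.update f i a) S) (wt P (Function.update f i a) (insert i S)) + δ) := by
    apply sum_le_sum
    intro S hS
    have := class_bound (P.filter fun p => e p = S) δ (fun p hp q hq =>
      hs p (mem_filter.1 hp).1 q (mem_filter.1 hq).1)
    simp_rw [w1 _ S (hiT S hS), w2 _ S (hiT S hS)]
    exact this
  rw [← mul_sum, ← hP, sum_add_distrib, sum_const, smul_eq_mul, ← mul_sum, sum_comm] at step
  refine step.trans ?_
  rw [mul_comm δ]
  apply add_le_add _ (Nat.mul_le_mul_right _ hTle)
  apply Nat.mul_le_mul_left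
  apply sum_le_sum
  intro a _
  rw [W]
  apply sum_le_sum_of_subset
  intro S hS
  simp [hiT S hS]

lemma W_upper [Fintype ι] (P : Finset (Finset α)) (d : ℕ)
    (hd : ∀ S, P.Shatters S → #S ≤ d) (f : ι → α) : ∑ i, W P f i ≤ d * #P := by
  have hP : #P = ∑ S, wt P f S :=
    card_eq_sum_card_fiberwise (fun p _ => mem_coe.2 (mem_univ (tr f p)))
  rw [hP]
  apply weighted
  intro J hJ
  have hex : ∀ t ⊆ J, ∃ p ∈ P, ∀ j ∈ J, f j ∈ p ↔ j ∈ t := by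
    intro t ht
    obtain ⟨u, hu, hJu⟩ := hJ ht
    rw [mem_filter, wt, card_pos] at hu
    obtain ⟨p, hp⟩ := hu.2
    rw [mem_filter] at hp
    refine ⟨p, hp.1, fun j hj => ?_⟩
    rw [← hJu, ← hp.2]
    simp [tr, hj]
  have hinj : Set.InjOn f J := by
    intro x hx y hy hxy
    obtain ⟨p, _, h⟩ := hex {x} (by simpa using hx)
    have h1 := (h x hx).2 (by simp)
    rw [hxy] at h1
    have := (h y hy).1 h1
    exact (mem_singleton.1 this).symm
  rw [← card_image_of_injOn hinj]
  apply hd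
  intro t ht
  obtain ⟨p, hp, h⟩ := hex (J.filter fun j => f j ∈ t) (filter_subset _ _)
  refine ⟨p, hp, ?_⟩
  ext x
  rw [mem_inter, mem_image]
  constructor
  · rintro ⟨⟨j, hj, rfl⟩, hx⟩
    exact (mem_filter.1 ((h j hj).1 hx)).2
  · intro hx
    obtain ⟨j, hj, rfl⟩ := mem_image.1 (ht hx)
    exact ⟨⟨j, hj, rfl⟩, (h j hj).2 (mem_filter.2 ⟨hj, hx⟩)⟩

lemma resample [Fintype ι] [Fintype α] (i : ι) (φ : (ι → α) → ℕ) :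
    ∑ f : ι → α, ∑ a, φ (Function.update f i a) = Fintype.card α * ∑ f, φ f := by
  have hinv : Function.Involutive
      (fun x : (ι → α) × α => (Function.update x.1 i x.2, x.1 i)) := by
    rintro ⟨f, a⟩; simp
  rw [← Fintype.sum_prod_type' (f := fun f a => φ (Function.update f i a))]
  have h := Equiv.sum_comp (hinv.toPerm _) (fun x : (ι → α) × α => φ x.1)
  simp only [Function.Involutive.coe_toPerm] at h
  rw [h, Fintype.sum_prod_type]
  simp [mul_sum]

lemma haussler [Fintype ι] [Fintype α] (P : Finset (Finset α)) (δ d : ℕ)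
    (hs : ∀ p ∈ P, ∀ q ∈ P, p ≠ q → δ < #(p ∆ q))
    (hd : ∀ S, P.Shatters S → #S ≤ d) :
    Fintype.card ι * (Fintype.card (ι → α) * (δ * #P)) ≤
      2 * (Fintype.card α * (Fintype.card (ι → α) * (d * #P)))
      + Fintype.card ι * (δ * ∑ f : ι → α, #(P.image (tr f))) := by
  have h1 : ∀ i : ι, Fintype.card (ι → α) * (δ * #P) ≤
      2 * (Fintype.card α * ∑ f : ι → α, W P f i) + δ * ∑ f : ι → α, #(P.image (tr f)) := by
    intro i
    rw [← resample i (fun f => W P f i), mul_sum, mul_sum, ← sum_add_distrib,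
      ← smul_eq_mul, ← card_univ]
    exact card_nsmul_le_sum _ _ _ (fun f _ => W_lower P δ hs f i)
  have h2 := card_nsmul_le_sum univ _ _ (fun i _ => h1 i)
  rw [smul_eq_mul, card_univ, sum_add_distrib, sum_const, card_univ, smul_eq_mul,
    ← mul_sum, ← mul_sum, sum_comm] at h2
  refine h2.trans ?_
  gcongr
  rw [← smul_eq_mul, ← card_univ]
  exact sum_le_card_nsmul _ _ _ (fun f _ => W_upper P d hd f)

lemma markov [Fintype ι] [Fintype α] (p : Finset α) :
    Fintype.card α * ∑ f : ι → α, #(tr f p) = Fintype.card ι * (Fintype.card (ι → α) * #p) := by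
  simp_rw [tr, card_filter]
  rw [sum_comm, mul_sum]
  have : ∀ i : ι, ∑ f : ι → α, ∑ a, (if Function.update f i a i ∈ p then 1 else 0)
      = Fintype.card (ι → α) * #p := by
    intro i
    simp
  have h2 : ∀ i : ι, Fintype.card α * ∑ f : ι → α, (if f i ∈ p then 1 else 0)
      = Fintype.card (ι → α) * #p := by
    intro i
    rw [← this i, resample i (fun f => if f i ∈ p then 1 else 0)]
  rw [sum_congr rfl (fun i _ => h2 i)]
  simp

lemma trace_card [Fintype ι] (P : Finset (Finset α)) (f : ι → α) (k : ℕ) :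
    k * #(P.image (tr f)) ≤ ∑ p ∈ P, #(tr f p) +
     k * #((P.image fun p => p ∩ univ.image f).filter fun s => #s ≤ k) := by
  set Y := univ.image f with hY
  have htr : ∀ p, tr f (p ∩ Y) = tr f p := by
    intro p; ext j; simp [tr, hY]
  have hcard : ∀ p, #(p ∩ Y) ≤ #(tr f p) := by
    intro p
    have : p ∩ Y ⊆ (tr f p).image f := by
      intro x hx
      rw [mem_inter, hY, mem_image] at hx
      obtain ⟨hx, j, _, rfl⟩ := hx
      exact mem_image_of_mem _ (by simp [tr, hx])
    exact (card_le_card this).trans card_image_le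
  set G := (P.image fun p => p ∩ Y).filter fun s => #s ≤ k
  have hsub : P.image (tr f) ⊆ (P.filter fun p => k < #(tr f p)).image (tr f) ∪ G.image (tr f) := by
    intro S hS
    obtain ⟨p, hp, rfl⟩ := mem_image.1 hS
    rw [mem_union]
    by_cases h : k < #(tr f p)
    · left; exact mem_image_of_mem _ (mem_filter.2 ⟨hp, h⟩)
    · right
      rw [← htr p]
      exact mem_image_of_mem _ (mem_filter.2 ⟨mem_image_of_mem _ hp,
        (hcard p).trans (not_lt.1 h)⟩)
  have h1 := (card_le_card hsub).trans ((card_union_le _ _).trans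
    (add_le_add card_image_le card_image_le))
  have h2 : k * #(P.filter fun p => k < #(tr f p)) ≤ ∑ p ∈ P, #(tr f p) := by
    rw [mul_comm, ← smul_eq_mul]
    refine (card_nsmul_le_sum _ (fun p => #(tr f p)) k ?_).trans
      (sum_le_sum_of_subset (filter_subset _ _))
    intro p hp
    exact (mem_filter.1 hp).2.le
  calc _ ≤ k * _ := Nat.mul_le_mul_left k h1
    _ ≤ _ := by rw [mul_add]; gcongr

lemma exp_beats (C d : ℝ) : ∃ d0 : ℕ, 1 ≤ d0 ∧ ∀ v : ℕ, d0 < v → C * (v : ℝ) ^ d < 2 ^ v := by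
  have h := (isLittleO_rpow_exp_pos_mul_atTop d (b := Real.log 2) (Real.log_pos (by norm_num)))
  have h2 := (h.const_mul_left C).comp_tendsto tendsto_natCast_atTop_atTop
  have h3 := h2.def (c := 1/2) (by norm_num)
  obtain ⟨N, hN⟩ := Filter.eventually_atTop.1 h3
  refine ⟨N + 1, by omega, fun v hv => ?_⟩
  have h4 := hN v (by omega)
  simp only [Function.comp, Real.norm_eq_abs, Real.abs_exp] at h4
  have h5 : Real.exp (Real.log 2 * v) = 2 ^ v := by
    rw [← Real.rpow_def_of_pos (by norm_num), Real.rpow_natCast]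
  rw [h5] at h4
  have h6 : (0:ℝ) < 2 ^ v := by positivity
  have := le_abs_self (C * (v:ℝ) ^ d)
  linarith

lemma G_bound [Fintype ι] [Nonempty ι] (P : Finset (Finset α)) (C d₁ d₂ : ℝ) (hC : 0 < C)
    (hd₁ : 1 ≤ d₁) (hd₂ : 0 ≤ d₂)
    (hyp : ∀ Y : Finset α, Y.Nonempty → ∀ k : ℕ, 1 ≤ k → k ≤ Y.card →
          ((((P.image fun p => p ∩ Y).filter fun s => s.card ≤ k).card : ℝ))
            ≤ C * (Y.card : ℝ) ^ d₁ * (k : ℝ) ^ d₂) (f : ι → α) (k : ℕ) (hk : 1 ≤ k) :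
    (#((P.image fun p => p ∩ univ.image f).filter fun s => #s ≤ k) : ℝ)
      ≤ C * (Fintype.card ι : ℝ) ^ d₁ * (k : ℝ) ^ d₂ := by
  set Y := univ.image f with hY
  have hne : Y.Nonempty := univ_nonempty.image f
  have hYc : #Y ≤ Fintype.card ι := card_image_le
  have hpos : 1 ≤ #Y := card_pos.2 hne
  have h := hyp Y hne (min k #Y) (le_min hk hpos) (min_le_right _ _)
  have hsub : ((P.image fun p => p ∩ Y).filter fun s => #s ≤ k) ⊆
      ((P.image fun p => p ∩ Y).filter fun s => #s ≤ min k #Y) := by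
    intro s hs
    rw [mem_filter] at hs ⊢
    refine ⟨hs.1, le_min hs.2 ?_⟩
    obtain ⟨p, _, rfl⟩ := mem_image.1 hs.1
    exact card_le_card inter_subset_right
  refine (Nat.cast_le.2 (card_le_card hsub)).trans (h.trans ?_)
  gcongr
  exact min_le_left _ _

lemma vc_bound (P : Finset (Finset α)) (C d₁ d₂ : ℝ) (d : ℕ)
    (hd : ∀ v : ℕ, d < v → C * (v : ℝ) ^ (d₁ + d₂) < 2 ^ v)
    (hyp : ∀ Y : Finset α, Y.Nonempty → ∀ k : ℕ, 1 ≤ k → k ≤ Y.card →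
          ((((P.image fun p => p ∩ Y).filter fun s => s.card ≤ k).card : ℝ))
            ≤ C * (Y.card : ℝ) ^ d₁ * (k : ℝ) ^ d₂) (S : Finset α) (hS : P.Shatters S) :
    #S ≤ d := by
  by_contra hlt
  push Not at hlt
  have hpos : 0 < #S := by omega
  have h := hyp S (card_pos.1 hpos) #S hpos le_rfl
  have hsub : S.powerset ⊆ ((P.image fun p => p ∩ S).filter fun s => s.card ≤ #S) := by
    intro t ht
    obtain ⟨u, hu, hSu⟩ := hS (mem_powerset.1 ht)
    rw [mem_filter]
    exact ⟨mem_image.2 ⟨u, hu, by rw [inter_comm, hSu]⟩, card_le_card (mem_powerset.1 ht)⟩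
  have h2 := card_le_card hsub
  rw [card_powerset] at h2
  have h3 := (Nat.cast_le (α := ℝ)).2 h2
  have h4 := hd _ hlt
  rw [Real.rpow_add (by exact_mod_cast hpos)] at h4
  push_cast at h3
  linarith

end SSP




/-- Size-sensitive packing lemma: for constants `C > 0`, `d₁ ≥ 1`, `d₂ ≥ 0` with
`d₁ + d₂ > 1` there is `c* > 0` such that any `δ`-separated family of `l`-element
sets on an `n`-point set with size-sensitive shatter function at most `C·m^{d₁}·k^{d₂}`
has cardinality at most `c*·(n/δ)^{d₁}·(l/δ)^{d₂}`. -/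
theorem size_sensitive_packing (C d₁ d₂ : ℝ) (hC : 0 < C) (hd₁ : 1 ≤ d₁)
    (hd₂ : 0 ≤ d₂) (hd : 1 < d₁ + d₂) :
    ∃ cstar : ℝ, 0 < cstar ∧
      ∀ (α : Type) (_ : Fintype α) (_ : DecidableEq α) (n δ l : ℕ)
        (P : Finset (Finset α)),
        Fintype.card α = n → 1 ≤ δ → δ ≤ l → l ≤ n →
        (∀ p ∈ P, p.card = l) →
        (∀ P₁ ∈ P, ∀ P₂ ∈ P, P₁ ≠ P₂ → δ < (P₁ ∆ P₂).card) →
        (∀ Y : Finset α, Y.Nonempty → ∀ k : ℕ, 1 ≤ k → k ≤ Y.card →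
          ((((P.image fun p => p ∩ Y).filter fun s => s.card ≤ k).card : ℝ))
            ≤ C * (Y.card : ℝ) ^ d₁ * (k : ℝ) ^ d₂) →
        (P.card : ℝ) ≤ cstar * ((n : ℝ) / δ) ^ d₁ * ((l : ℝ) / δ) ^ d₂ := by
  classical
  obtain ⟨d, hd1, hdv⟩ := SSP.exp_beats C (d₁ + d₂)
  refine ⟨4 * C * (4 * d + 1 : ℝ) ^ d₁ * (16 * d + 5 : ℝ) ^ d₂, by positivity, ?_⟩
  intro α _ _ n δ l P hn hδ hδl hln hl hsep hyp
  have hvc := SSP.vc_bound P C d₁ d₂ d hdv hyp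
  have hδ' : (1:ℝ) ≤ δ := by exact_mod_cast hδ
  have hδl' : (δ:ℝ) ≤ l := by exact_mod_cast hδl
  have hln' : (l:ℝ) ≤ n := by exact_mod_cast hln
  have hd1' : (1:ℝ) ≤ d := by exact_mod_cast hd1
  have hn0 : (0:ℝ) < n := by linarith
  have hδ0 : (0:ℝ) < δ := by linarith
  have hl0 : (0:ℝ) < l := by linarith
  obtain ⟨m, hm⟩ : ∃ m, m = ⌈4 * (d:ℝ) * n / δ⌉₊ := ⟨_, rfl⟩
  have hm1 : 4 * (d:ℝ) * n ≤ m * δ := by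
    have := Nat.le_ceil (4 * (d:ℝ) * n / δ)
    rw [← hm, div_le_iff₀ hδ0] at this
    exact this
  have hm2 : (m:ℝ) ≤ (4 * d + 1) * (n / δ) := by
    have := (Nat.ceil_lt_add_one (a := 4 * (d:ℝ) * n / δ) (by positivity)).le
    rw [← hm] at this
    have h1 : 1 ≤ (n:ℝ) / δ := by rw [le_div_iff₀ hδ0]; linarith
    calc (m:ℝ) ≤ _ := this
      _ ≤ 4 * (d:ℝ) * n / δ + n / δ := by gcongr
      _ = _ := by ring
  have hm0 : (0:ℝ) < m := by
    by_contra h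
    have : (m:ℝ) * δ ≤ 0 := mul_nonpos_of_nonpos_of_nonneg (not_lt.1 h) hδ0.le
    have : 0 < 4 * (d:ℝ) * n := by positivity
    linarith
  obtain ⟨k, hk⟩ : ∃ k, k = ⌈4 * (m:ℝ) * l / n⌉₊ := ⟨_, rfl⟩
  have hk1 : 4 * (m:ℝ) * l ≤ k * n := by
    have := Nat.le_ceil (4 * (m:ℝ) * l / n)
    rw [← hk, div_le_iff₀ hn0] at this
    exact this
  have hk0 : 0 < k := by rw [hk, Nat.ceil_pos]; positivity
  have hk0' : (0:ℝ) < k := by exact_mod_cast hk0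
  have hk2 : (k:ℝ) ≤ (16 * d + 5) * (l / δ) := by
    have := (Nat.ceil_lt_add_one (a := 4 * (m:ℝ) * l / n) (by positivity)).le
    rw [← hk] at this
    have h1 : 1 ≤ (l:ℝ) / δ := by rw [le_div_iff₀ hδ0]; linarith
    calc (k:ℝ) ≤ _ := this
      _ ≤ 4 * ((4 * d + 1) * (n / δ)) * l / n + l / δ := by gcongr
      _ = _ := by field_simp; ring
  have hmN : 0 < m := by exact_mod_cast hm0
  haveI : Nonempty (Fin m) := ⟨⟨0, hmN⟩⟩
  obtain ⟨B, hB⟩ : ∃ B : ℝ, B = C * (m : ℝ) ^ d₁ * (k : ℝ) ^ d₂ := ⟨_, rfl⟩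
  have hG : ∀ f : Fin m → α, _ := fun f =>
    SSP.G_bound P C d₁ d₂ hC hd₁ hd₂ hyp f k hk0
  have hH := SSP.haussler (ι := Fin m) P δ d hsep hvc
  have hT := Finset.sum_le_sum (s := Finset.univ) (fun (f : Fin m → α) _ => SSP.trace_card P f k)
  rw [Finset.sum_add_distrib, ← Finset.mul_sum, ← Finset.mul_sum, Finset.sum_comm] at hT
  have hM : n * ∑ p ∈ P, ∑ f : Fin m → α, (SSP.tr f p).card
      = P.card * (m * (Fintype.card (Fin m → α) * l)) := by
    rw [Finset.mul_sum, Finset.sum_congr rfl (g := fun _ => m * (Fintype.card (Fin m → α) * l))]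
    · simp
    · intro p hp
      have := SSP.markov (ι := Fin m) p
      rw [hn, hl p hp, Fintype.card_fin] at this
      exact this
  rw [hn, Fintype.card_fin] at hH
  simp only [Fintype.card_fin, ← hB] at hG
  have hGs := Finset.sum_le_card_nsmul Finset.univ _ B (fun f _ => hG f)
  rw [nsmul_eq_mul, Finset.card_univ, ← Nat.cast_sum] at hGs
  have hN0 : 0 < Fintype.card (Fin m → α) := by
    rw [Fintype.card_fun, hn]
    exact Nat.pow_pos (by exact_mod_cast hn0)
  generalize Fintype.card (Fin m → α) = N at *
  generalize (∑ f : Fin m → α, (P.image (SSP.tr f)).card) = T at *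
  generalize (∑ p ∈ P, ∑ f : Fin m → α, (SSP.tr f p).card) = S at *
  generalize (∑ f : Fin m → α, _ : ℕ) = G at hT hGs
  have hN0' : (0:ℝ) < N := by exact_mod_cast hN0
  have hH' : (m:ℝ) * (N * (δ * P.card)) ≤ 2 * (n * (N * (d * P.card))) + m * (δ * T) := by
    exact_mod_cast hH
  have hT' : (k:ℝ) * T ≤ S + k * G := by exact_mod_cast hT
  have hM' : (n:ℝ) * S = P.card * (m * (N * l)) := by exact_mod_cast hM
  have hp0 : (0:ℝ) ≤ P.card := by positivity
  generalize (P.card : ℝ) = p at *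
  have e1 : N * p ≤ 2 * (T:ℝ) := by
    have h1 : 4 * (d:ℝ) * n * (N * p) ≤ m * δ * (N * p) := by gcongr
    have h2 : (m * δ : ℝ) * (N * p) ≤ m * δ * (2 * T) := by linarith
    exact le_of_mul_le_mul_left h2 (by positivity)
  have e2 : 4 * (S:ℝ) ≤ k * (p * N) := by
    have h1 : 4 * (m:ℝ) * l * (p * N) ≤ k * n * (p * N) := by gcongr
    have h2 : (n:ℝ) * (4 * S) ≤ n * (k * (p * N)) := by linarith
    exact le_of_mul_le_mul_left h2 hn0
  have e3 : (T:ℝ) ≤ p * N / 4 + N * B := by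
    have h1 : (k:ℝ) * G ≤ k * (N * B) := by gcongr
    have h2 : (k:ℝ) * T ≤ k * (p * N / 4 + N * B) := by linarith
    exact le_of_mul_le_mul_left h2 hk0'
  have e4 : p ≤ 4 * B := by
    have h2 : (N:ℝ) * p ≤ N * (4 * B) := by linarith
    exact le_of_mul_le_mul_left h2 hN0'
  refine e4.trans ?_
  rw [hB]
  calc 4 * (C * (m : ℝ) ^ d₁ * (k : ℝ) ^ d₂)
      ≤ 4 * (C * ((4 * d + 1) * (n / δ) : ℝ) ^ d₁ * ((16 * d + 5) * (l / δ) : ℝ) ^ d₂) := by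
        gcongr
    _ = _ := by
        rw [Real.mul_rpow (by positivity) (by positivity),
          Real.mul_rpow (by positivity) (by positivity)]
        ring
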